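/- Let n ≥ 2, let z₁, …, z_m be points of ℝ^{n−1} and d₀, d₁, …, d_m positive reals such that: (a) ‖z_j‖² > max(0, d_j² − d₀²) for 1 ≤ j ≤ m; (b) |d₀ − d_i| ≤ ‖z_i‖ ≤ √(d₀² + d_i²) for 1 ≤ i ≤ m; (c) √(d_i² + d_j²) ≤ ‖z_i − z_j‖ ≤ d_i + d_j for 1 ≤ i < j ≤ m. Then there exist vectors h, w₀, w₁, …, w_m ∈ ℝⁿ × ℝ such that for all distinct indices 0 ≤ i, j ≤ m: I(h,h) > 0 > I(w_i,w_i), I(h,w_i) > 0, I(w_i,w_j) ≥ 0, and I(a·w_i + b·w_j, a·w_i + b·w_j) ≤ 0 for all real a, b ≥ 0. -/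

import Mathlib

open scoped RealInnerProductSpace

/-- The Minkowski form `I((v,u),(v',u')) = -⟨v,v'⟩ + u·u'` on `ℝⁿ × ℝ`. -/
noncomputable def minkI {n : ℕ} (w w' : EuclideanSpace ℝ (Fin n) × ℝ) : ℝ :=
  -⟪w.1, w'.1⟫ + w.2 * w'.2

/-- The vector of `ℝᵏ⁺¹ × ℝ` with light-cone coordinates `(x, q)`, that is, with components
`x`, `(q - 1) / 2` and `(q + 1) / 2`. -/
noncomputable def lightConeVec {k : ℕ} (x : EuclideanSpace ℝ (Fin k)) (q : ℝ) :
    EuclideanSpace ℝ (Fin (k + 1)) × ℝ :=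
  (WithLp.toLp 2 (Fin.cons ((q - 1) / 2) x : Fin (k + 1) → ℝ), (q + 1) / 2)

/-- The vector of `ℝᵏ⁺¹ × ℝ` representing the ball with centre `x` and radius `r` in the boundary
of the upper half-space model, scaled to have Minkowski square `-r ^ 2`. -/
noncomputable def ballVec {k : ℕ} (x : EuclideanSpace ℝ (Fin k)) (r : ℝ) :
    EuclideanSpace ℝ (Fin (k + 1)) × ℝ :=
  lightConeVec x (‖x‖ ^ 2 - r ^ 2)

/-- The vector of `ℝᵏ⁺¹ × ℝ` pairing with light-cone coordinates `(x, q)` to `q + t`. -/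
noncomputable def heightVec (k : ℕ) (t : ℝ) : EuclideanSpace ℝ (Fin (k + 1)) × ℝ :=
  (WithLp.toLp 2 (Fin.cons (t - 1) 0 : Fin (k + 1) → ℝ), t + 1)

theorem minkI_comm {n : ℕ} (w w' : EuclideanSpace ℝ (Fin n) × ℝ) : minkI w w' = minkI w' w := by
  simp only [minkI, real_inner_comm, mul_comm]

theorem minkI_neg_left {n : ℕ} (w w' : EuclideanSpace ℝ (Fin n) × ℝ) :
    minkI (-w) w' = -minkI w w' := by
  simp only [minkI, Prod.fst_neg, Prod.snd_neg, inner_neg_left]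
  ring

theorem minkI_neg_right {n : ℕ} (w w' : EuclideanSpace ℝ (Fin n) × ℝ) :
    minkI w (-w') = -minkI w w' := by
  rw [minkI_comm, minkI_neg_left, minkI_comm]

theorem minkI_smul_add_smul_self {n : ℕ} (w w' : EuclideanSpace ℝ (Fin n) × ℝ) (a b : ℝ) :
    minkI (a • w + b • w') (a • w + b • w') =
      a ^ 2 * minkI w w + 2 * (a * b) * minkI w w' + b ^ 2 * minkI w' w' := by
  simp only [minkI, Prod.fst_add, Prod.snd_add, Prod.smul_fst, Prod.smul_snd, inner_add_left,
    inner_add_right, real_inner_smul_left, real_inner_smul_right, smul_eq_mul,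
    real_inner_comm w.1 w'.1]
  ring

/-- Two vectors whose Minkowski product is at most the product of their lengths span a cone
on which the Minkowski form is nonpositive. -/
theorem minkI_smul_add_smul_self_nonpos {n : ℕ} {w w' : EuclideanSpace ℝ (Fin n) × ℝ} {r s : ℝ}
    (hw : minkI w w = -r ^ 2) (hw' : minkI w' w' = -s ^ 2) (h : minkI w w' ≤ r * s)
    {a b : ℝ} (ha : 0 ≤ a) (hb : 0 ≤ b) :
    minkI (a • w + b • w') (a • w + b • w') ≤ 0 := by
  rw [minkI_smul_add_smul_self, hw, hw']
  nlinarith [mul_le_mul_of_nonneg_left h (mul_nonneg ha hb), sq_nonneg (a * r - b * s)]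

theorem minkI_lightConeVec {k : ℕ} (x y : EuclideanSpace ℝ (Fin k)) (p q : ℝ) :
    minkI (lightConeVec x p) (lightConeVec y q) = (p + q) / 2 - ⟪x, y⟫ := by
  simp only [minkI, lightConeVec, PiLp.inner_apply, Fin.sum_univ_succ, Fin.cons_zero,
    Fin.cons_succ, Real.inner_apply]
  ring

theorem minkI_heightVec_lightConeVec {k : ℕ} (t : ℝ) (x : EuclideanSpace ℝ (Fin k)) (q : ℝ) :
    minkI (heightVec k t) (lightConeVec x q) = q + t := by
  simp only [minkI, heightVec, lightConeVec, PiLp.inner_apply, Fin.sum_univ_succ, Fin.cons_zero,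
    Fin.cons_succ, Real.inner_apply, Pi.zero_apply, zero_mul, Finset.sum_const_zero]
  ring

theorem minkI_heightVec_self (k : ℕ) (t : ℝ) : minkI (heightVec k t) (heightVec k t) = 4 * t := by
  simp only [minkI, heightVec, PiLp.inner_apply, Fin.sum_univ_succ, Fin.cons_zero,
    Fin.cons_succ, Real.inner_apply, Pi.zero_apply, zero_mul, Finset.sum_const_zero]
  ring

theorem minkI_ballVec {k : ℕ} (x y : EuclideanSpace ℝ (Fin k)) (r s : ℝ) :
    minkI (ballVec x r) (ballVec y s) = (‖x - y‖ ^ 2 - r ^ 2 - s ^ 2) / 2 := by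
  rw [ballVec, ballVec, minkI_lightConeVec, norm_sub_sq_real]
  ring

theorem minkI_ballVec_self {k : ℕ} (x : EuclideanSpace ℝ (Fin k)) (r : ℝ) :
    minkI (ballVec x r) (ballVec x r) = -r ^ 2 := by
  rw [minkI_ballVec, sub_self, norm_zero]
  ring

/-- Finitely many reals below a positive `c` have a common positive strict upper bound below `c`. -/
theorem exists_pos_lt_forall_lt {ι : Type*} [Finite ι] {c : ℝ} (hc : 0 < c) (f : ι → ℝ)
    (hf : ∀ i, f i < c) : ∃ t, 0 < t ∧ t < c ∧ ∀ i, f i < t := by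
  obtain ⟨t, ht, htc⟩ := Set.Finite.exists_between'
    (Set.finite_range fun o : Option ι => o.elim 0 f) (Set.finite_singleton c)
    (by rintro _ ⟨_ | i, rfl⟩ _ rfl <;> simp [hc, hf])
  exact ⟨t, ht _ ⟨none, rfl⟩, htc c rfl, fun i => ht _ ⟨some i, rfl⟩⟩

theorem exists_minkI_code_of_balls {k m : ℕ}
    (z : Fin m → EuclideanSpace ℝ (Fin k)) (d₀ : ℝ) (d : Fin m → ℝ)
    (hd₀ : 0 < d₀) (hd : ∀ i, 0 < d i)
    (ha : ∀ j, d j ^ 2 - d₀ ^ 2 < ‖z j‖ ^ 2)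
    (hb : ∀ i, |d₀ - d i| ≤ ‖z i‖ ∧ ‖z i‖ ≤ Real.sqrt (d₀ ^ 2 + d i ^ 2))
    (hc : ∀ i j, i ≠ j →
      Real.sqrt (d i ^ 2 + d j ^ 2) ≤ ‖z i - z j‖ ∧ ‖z i - z j‖ ≤ d i + d j) :
    ∃ (h : EuclideanSpace ℝ (Fin (k + 1)) × ℝ)
      (w : Fin (m + 1) → EuclideanSpace ℝ (Fin (k + 1)) × ℝ),
      0 < minkI h h ∧ (∀ i, minkI (w i) (w i) < 0) ∧ (∀ i, 0 < minkI h (w i)) ∧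
      ∀ i j, i ≠ j → 0 ≤ minkI (w i) (w j) ∧
        ∀ a b : ℝ, 0 ≤ a → 0 ≤ b →
          minkI (a • w i + b • w j) (a • w i + b • w j) ≤ 0 := by
  obtain ⟨t, ht, htd₀, htd⟩ := exists_pos_lt_forall_lt (sq_pos_of_pos hd₀)
    (fun j => d j ^ 2 - ‖z j‖ ^ 2) (fun j => by linarith [ha j])
  set w : Fin (m + 1) → EuclideanSpace ℝ (Fin (k + 1)) × ℝ :=
    Fin.cons (-ballVec 0 d₀) fun i => ballVec (z i) (d i) with hw
  set r : Fin (m + 1) → ℝ := Fin.cons d₀ d with hr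
  have hself : ∀ i, minkI (w i) (w i) = -r i ^ 2 := by
    refine Fin.cases ?_ fun i => ?_
    · simp [hw, hr, minkI_neg_left, minkI_neg_right, minkI_ballVec_self]
    · simp [hw, hr, minkI_ballVec_self]
  have hrpos : ∀ i, 0 < r i := Fin.cases hd₀ hd
  have hfirst : ∀ i : Fin m, 0 ≤ minkI (w 0) (w i.succ) ∧
      minkI (w 0) (w i.succ) ≤ r 0 * r i.succ := by
    intro i
    simp only [hw, hr, Fin.cons_zero, Fin.cons_succ, minkI_neg_left, minkI_ballVec, zero_sub,
      norm_neg]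
    have hlow := pow_le_pow_left₀ (abs_nonneg _) (hb i).1 2
    have hupp := (Real.le_sqrt (norm_nonneg _) (by positivity)).1 (hb i).2
    rw [sq_abs] at hlow
    constructor <;> nlinarith
  have hpair : ∀ i j, i ≠ j → 0 ≤ minkI (w i) (w j) ∧ minkI (w i) (w j) ≤ r i * r j := by
    refine Fin.cases (Fin.cases (fun h => absurd rfl h) fun j _ => hfirst j) fun i =>
      Fin.cases (fun _ => ?_) fun j hij => ?_
    · rw [minkI_comm, mul_comm]
      exact hfirst i
    · obtain ⟨hlow, hupp⟩ := hc i j fun h => hij (congrArg Fin.succ h)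
      have hlow := (Real.sqrt_le_left (norm_nonneg _)).1 hlow
      have hupp := pow_le_pow_left₀ (norm_nonneg _) hupp 2
      simp only [hw, hr, Fin.cons_succ, minkI_ballVec]
      constructor <;> nlinarith
  refine ⟨heightVec k t, w, ?_, fun i => ?_, ?_, fun i j hij => ⟨(hpair i j hij).1, fun a b =>
    minkI_smul_add_smul_self_nonpos (hself i) (hself j) (hpair i j hij).2⟩⟩
  · rw [minkI_heightVec_self]
    linarith
  · rw [hself]
    exact neg_neg_of_pos (pow_pos (hrpos i) 2)
  · refine Fin.cases ?_ fun i => ?_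
    · simp [hw, minkI_neg_right, ballVec, minkI_heightVec_lightConeVec, htd₀]
    · simp only [hw, Fin.cons_succ, ballVec, minkI_heightVec_lightConeVec]
      linarith [htd i]

theorem stmt15 {n m : ℕ} (hn : 2 ≤ n)
    (z : Fin m → EuclideanSpace ℝ (Fin (n - 1))) (d₀ : ℝ) (d : Fin m → ℝ)
    (hd₀ : 0 < d₀) (hd : ∀ i, 0 < d i)
    (ha : ∀ j, max 0 (d j ^ 2 - d₀ ^ 2) < ‖z j‖ ^ 2)
    (hb : ∀ i, |d₀ - d i| ≤ ‖z i‖ ∧ ‖z i‖ ≤ Real.sqrt (d₀ ^ 2 + d i ^ 2))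
    (hc : ∀ i j, i ≠ j →
      Real.sqrt (d i ^ 2 + d j ^ 2) ≤ ‖z i - z j‖ ∧ ‖z i - z j‖ ≤ d i + d j) :
    ∃ (h : EuclideanSpace ℝ (Fin n) × ℝ)
      (w : Fin (m + 1) → EuclideanSpace ℝ (Fin n) × ℝ),
      0 < minkI h h ∧ (∀ i, minkI (w i) (w i) < 0) ∧ (∀ i, 0 < minkI h (w i)) ∧
      ∀ i j, i ≠ j → 0 ≤ minkI (w i) (w j) ∧
        ∀ a b : ℝ, 0 ≤ a → 0 ≤ b →
          minkI (a • w i + b • w j) (a • w i + b • w j) ≤ 0 := by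
  obtain ⟨k, rfl⟩ : ∃ k, n = k + 1 := ⟨n - 1, by omega⟩
  exact exists_minkI_code_of_balls z d₀ d hd₀ hd
    (fun j => (le_max_right _ _).trans_lt (ha j)) hb hc
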